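/- In the descent algebra ΣD_4 of the Coxeter group D_4, the following identity holds: B_{[4]} · B_{[2]} = 2 B_{[2,2]} + B_{[2,1,1]'}, where [4] and [2,2] are taken in C_4, [2,1,1]' is taken in C_4', and [2] is taken in C_{<4}. -/

import Mathlib

open scoped Classical

namespace DescentD

/-- The domain on which the Coxeter group `D_n` acts: the pair `(k, b)` encodes the
integer `k + 1` if `b = true` and `-(k + 1)` if `b = false`.  (We use `Fin (n + 1)`
so that the type is always nonempty; only the points with `k < n` are moved.) -/
abbrev Dom (n : ℕ) := Fin (n + 1) × Bool

/-- The point of `Dom n` encoding the nonzero integer `a` (for `1 ≤ |a| ≤ n`). -/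
def pt (n : ℕ) (a : ℤ) : Dom n :=
  (⟨(a.natAbs - 1) % (n + 1), Nat.mod_lt _ n.succ_pos⟩, decide (0 < a))

/-- The transposition exchanging the points encoding `a` and `b`. -/
def swapD (n : ℕ) (a b : ℤ) : Equiv.Perm (Dom n) := Equiv.swap (pt n a) (pt n b)

/-- The Coxeter generators of `D_n`:  index `0` is `s_{1'} = (-2,1)(-1,2)` and index
`i` with `1 ≤ i ≤ n - 1` is `s_i = (-i-1,-i)(i,i+1)`. -/
def gen (n : ℕ) (i : ℕ) : Equiv.Perm (Dom n) :=
  if i = 0 then swapD n (-2) 1 * swapD n (-1) 2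
  else swapD n (-(i : ℤ) - 1) (-(i : ℤ)) * swapD n (i : ℤ) ((i : ℤ) + 1)

/-- The Coxeter group `D_n`, as the subgroup generated by `s_{1'}, s_1, …, s_{n-1}`. -/
def Dgroup (n : ℕ) : Subgroup (Equiv.Perm (Dom n)) :=
  Subgroup.closure (gen n '' Set.Iio n)

/-- Coxeter length of `w` with respect to the generators of `D_n`. -/
noncomputable def len (n : ℕ) (w : Equiv.Perm (Dom n)) : ℕ :=
  sInf {k | ∃ l : List ℕ, (∀ i ∈ l, i < n) ∧ l.length = k ∧ (l.map (gen n)).prod = w}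

/-- The parabolic subgroup `W_J` for a set `J` of generator indices. -/
def WJ (n : ℕ) (J : Set ℕ) : Subgroup (Equiv.Perm (Dom n)) :=
  Subgroup.closure (gen n '' J)

/-- The set `X_J` of minimal length left coset representatives of `W_J` in `D_n`. -/
def X (n : ℕ) (J : Set ℕ) : Set (Equiv.Perm (Dom n)) :=
  {w | w ∈ Dgroup n ∧ ∀ u ∈ WJ n J, len n w ≤ len n (w * u)}

/-- `𝒳_J`: the sum, in the group algebra `ℚ[D_n]`, of the minimal length left coset
representatives of `W_J`. -/
noncomputable def XX (n : ℕ) (J : Set ℕ) : MonoidAlgebra ℚ (Equiv.Perm (Dom n)) :=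
  ∑ w : Equiv.Perm (Dom n),
    if w ∈ X n J then MonoidAlgebra.of ℚ (Equiv.Perm (Dom n)) w else 0

/-- `q` is a composition of `m`: a list of positive integers with sum `m`. -/
def IsComposition (q : List ℕ) (m : ℕ) : Prop := (∀ x ∈ q, 0 < x) ∧ q.sum = m

/-- The four families making up `C(n)`:  `C_{<n}`, `C_1`, `C_n` and `C_n'`. -/
inductive Kind | lt | one | reg | prime
deriving DecidableEq

/-- Membership of a composition in each of the four families of `C(n)`. -/
def memC (n : ℕ) : Kind → List ℕ → Prop
  | .lt, q => (∀ x ∈ q, 0 < x) ∧ q.sum + 2 ≤ n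
  | .one, q => (∀ x ∈ q, 0 < x) ∧ q.sum = n ∧ q.headD 0 = 1
  | .reg, q => (∀ x ∈ q, 0 < x) ∧ q.sum = n ∧ 2 ≤ q.headD 0
  | .prime, q => (∀ x ∈ q, 0 < x) ∧ q.sum = n ∧ 2 ≤ q.headD 0

/-- The sum of the first `j` components of `q`. -/
def psum (q : List ℕ) (j : ℕ) : ℕ := (q.take j).sum

/-- The subset of generator indices (`0` standing for `s_{1'}`, `i ≥ 1` for `s_i`)
corresponding to `q ∈ C(n)`. -/
def JofC (n : ℕ) : Kind → List ℕ → Set ℕ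
  | .lt, q => {s | ∃ j < q.length, s = (n - q.sum) + psum q j}
  | .one, q => {0} ∪ {s | ∃ j, 1 ≤ j ∧ j < q.length ∧ s = psum q j}
  | .reg, q => {0} ∪ {s | ∃ j, 1 ≤ j ∧ j < q.length ∧ s = psum q j}
  | .prime, q => {1} ∪ {s | ∃ j, 1 ≤ j ∧ j < q.length ∧ s = psum q j}

/-- The basis element `B_q = 𝒳_{J^c}` of `ΣD_n`, for `q` in the family `k` of `C(n)`. -/
noncomputable def B (n : ℕ) (k : Kind) (q : List ℕ) :
    MonoidAlgebra ℚ (Equiv.Perm (Dom n)) :=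
  XX n (Set.Iio n \ JofC n k q)

/-- The nonzero integer encoded by a point of `Dom 4`. -/
def toInt (p : Dom 4) : ℤ := if p.2 then (p.1 : ℕ) + 1 else -((p.1 : ℕ) + 1)

/-- The window `(w(1), w(2), w(3), w(4))` of a permutation of `Dom 4`. -/
def window (w : Equiv.Perm (Dom 4)) : ℤ × ℤ × ℤ × ℤ :=
  (toInt (w (0, true)), toInt (w (1, true)), toInt (w (2, true)), toInt (w (3, true)))

/-- The effect on windows of right multiplication by the generator `gen 4 i`. -/
def rightAct (i : ℕ) : ℤ × ℤ × ℤ × ℤ → ℤ × ℤ × ℤ × ℤ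
  | (a, b, c, d) => match i with
    | 0 => (-b, -a, c, d)
    | 1 => (b, a, c, d)
    | 2 => (a, c, b, d)
    | _ => (a, b, d, c)

/-- The action of the generator `gen 4 i` on integers. -/
def genInt (i : ℕ) (x : ℤ) : ℤ :=
  match i with
  | 0 => if x = 1 then -2 else if x = 2 then -1 else if x = -1 then 2 else if x = -2 then 1 else x
  | j + 1 =>
    if x = j + 1 then j + 2 else if x = j + 2 then j + 1
    else if x = -(j + 1) then -(j + 2) else if x = -(j + 2) then -(j + 1) else x

/-- The effect on windows of left multiplication by the generator `gen 4 i`. -/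
def leftAct (i : ℕ) : ℤ × ℤ × ℤ × ℤ → ℤ × ℤ × ℤ × ℤ
  | (a, b, c, d) => (genInt i a, genInt i b, genInt i c, genInt i d)

/-- Whether `gen 4 i` is a right descent of the element with the given window. -/
def isDescent (i : ℕ) : ℤ × ℤ × ℤ × ℤ → Bool
  | (a, b, c, d) => match i with
    | 0 => decide (a + b < 0)
    | 1 => decide (b < a)
    | 2 => decide (c < b)
    | _ => decide (d < c)

/-- The number of type `D` inversions of a window. -/
def inversions : ℤ × ℤ × ℤ × ℤ → ℕ
  | (a, b, c, d) =>
    let f (x y : ℤ) : ℕ := (decide (y < x)).toNat + (decide (x + y < 0)).toNat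
    f a b + f a c + f a d + f b c + f b d + f c d

/-- All the windows of elements of `D_4`. -/
def windows : List (ℤ × ℤ × ℤ × ℤ) :=
  let e : List ℤ := [-4, -3, -2, -1, 1, 2, 3, 4]
  e.flatMap fun a =>
    (e.filter fun b => !(b.natAbs == a.natAbs)).flatMap fun b =>
      (e.filter fun c => !(c.natAbs == a.natAbs) && !(c.natAbs == b.natAbs)).flatMap fun c =>
        (e.filter fun d => !(d.natAbs == a.natAbs) && !(d.natAbs == b.natAbs) &&
          !(d.natAbs == c.natAbs) && decide (0 < a * b * c * d)).map fun d => (a, b, c, d)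

/-- Multiply on the right by generators in `J` that are descents, at most `k` times. -/
def removeDescents (J : List ℕ) : ℕ → ℤ × ℤ × ℤ × ℤ → ℤ × ℤ × ℤ × ℤ
  | 0, y => y
  | k + 1, y => match J.find? fun i => isDescent i y with
    | none => y
    | some i => removeDescents J k (rightAct i y)

/-- Whether the window has no descent in `J`. -/
def noDescent (J : List ℕ) (y : ℤ × ℤ × ℤ × ℤ) : Bool := J.all fun i => !isDescent i y

/-- The element of `D_4` given by a word in the generators. -/
def ofWord (l : List ℕ) : Equiv.Perm (Dom 4) := (l.map (gen 4)).prod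

/-- The window of the element given by a word in the generators. -/
def wordWindow (l : List ℕ) : ℤ × ℤ × ℤ × ℤ := l.foldr leftAct (1, 2, 3, 4)

/-- Words for the minimal length left coset representatives of the parabolic subgroup
generated by `s_1, s_2, s_3`. -/
def cosetWords : List (List ℕ) :=
  [[], [0], [2, 0], [1, 2, 0], [3, 2, 0], [3, 1, 2, 0], [2, 3, 1, 2, 0], [0, 2, 3, 1, 2, 0]]

/-! ### The action of the generators -/

lemma gen_involutive : ∀ i < 4, gen 4 i * gen 4 i = 1 := by decide +kernel

lemma gen_flip : ∀ i < 4, ∀ p : Dom 4, gen 4 i (p.1, !p.2) = ((gen 4 i p).1, !(gen 4 i p).2) := by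
  decide +kernel

lemma gen_last : ∀ i < 4, ∀ b : Bool, gen 4 i (4, b) = (4, b) := by decide +kernel

lemma toInt_gen : ∀ i < 4, ∀ p : Dom 4, toInt (gen 4 i p) = genInt i (toInt p) := by
  decide +kernel

lemma toInt_injective : Function.Injective toInt := by
  have h : ∀ p q : Dom 4, toInt p = toInt q → p = q := by decide +kernel
  exact fun p q => h p q

lemma toInt_flip (p : Dom 4) : toInt (p.1, !p.2) = -toInt p := by
  obtain ⟨k, b⟩ := p
  cases b <;> simp [toInt]

lemma ofWord_cons (i : ℕ) (l : List ℕ) : ofWord (i :: l) = gen 4 i * ofWord l := by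
  simp [ofWord]

lemma ofWord_append (l m : List ℕ) : ofWord (l ++ m) = ofWord l * ofWord m := by
  simp [ofWord]

lemma ofWord_inv {l : List ℕ} (hl : ∀ i ∈ l, i < 4) : (ofWord l)⁻¹ = ofWord l.reverse := by
  induction l with
  | nil => simp [ofWord]
  | cons i l ih =>
    have hi : (gen 4 i)⁻¹ = gen 4 i :=
      inv_eq_of_mul_eq_one_left (gen_involutive i (hl i (by simp)))
    rw [ofWord_cons, mul_inv_rev, ih fun j hj => hl j (by simp [hj]), List.reverse_cons,
      ofWord_append, hi]
    simp [ofWord]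

lemma exists_word {J : Set ℕ} (hJ : ∀ i ∈ J, i < 4) {w : Equiv.Perm (Dom 4)}
    (hw : w ∈ WJ 4 J) : ∃ l : List ℕ, (∀ i ∈ l, i ∈ J) ∧ ofWord l = w := by
  induction hw using Subgroup.closure_induction with
  | mem x hx =>
    obtain ⟨i, hi, rfl⟩ := hx
    exact ⟨[i], by simpa using hi, by simp [ofWord]⟩
  | one => exact ⟨[], by simp, by simp [ofWord]⟩
  | mul x y _ _ hx hy =>
    obtain ⟨l, hl, rfl⟩ := hx
    obtain ⟨m, hm, rfl⟩ := hy
    refine ⟨l ++ m, fun i hi => ?_, ofWord_append l m⟩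
    exact (List.mem_append.1 hi).elim (hl i) (hm i)
  | inv x _ hx =>
    obtain ⟨l, hl, rfl⟩ := hx
    exact ⟨l.reverse, by simpa using hl, (ofWord_inv fun i hi => hJ i (hl i hi)).symm⟩

lemma ofWord_mem {l : List ℕ} (hl : ∀ i ∈ l, i < 4) : ofWord l ∈ Dgroup 4 := by
  refine Subgroup.list_prod_mem _ fun x hx => ?_
  obtain ⟨i, hi, rfl⟩ := List.mem_map.1 hx
  exact Subgroup.subset_closure ⟨i, hl i hi, rfl⟩

lemma mem_Dgroup {w : Equiv.Perm (Dom 4)} :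
    w ∈ Dgroup 4 ↔ ∃ l : List ℕ, (∀ i ∈ l, i < 4) ∧ ofWord l = w := by
  constructor
  · exact fun hw => exists_word (J := Set.Iio 4) (fun _ h => h) hw
  · rintro ⟨l, hl, rfl⟩
    exact ofWord_mem hl

lemma gen_mem {i : ℕ} (hi : i < 4) : gen 4 i ∈ Dgroup 4 :=
  Subgroup.subset_closure ⟨i, hi, rfl⟩

lemma map_flip {w : Equiv.Perm (Dom 4)} (hw : w ∈ Dgroup 4) (p : Dom 4) :
    w (p.1, !p.2) = ((w p).1, !(w p).2) := by
  obtain ⟨l, hl, rfl⟩ := mem_Dgroup.1 hw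
  clear hw
  induction l with
  | nil => simp [ofWord]
  | cons i l ih =>
    rw [ofWord_cons, Equiv.Perm.mul_apply, Equiv.Perm.mul_apply,
      ih fun j hj => hl j (by simp [hj]), gen_flip i (hl i (by simp))]

lemma map_last {w : Equiv.Perm (Dom 4)} (hw : w ∈ Dgroup 4) (b : Bool) : w (4, b) = (4, b) := by
  obtain ⟨l, hl, rfl⟩ := mem_Dgroup.1 hw
  clear hw
  induction l with
  | nil => simp [ofWord]
  | cons i l ih =>
    rw [ofWord_cons, Equiv.Perm.mul_apply, ih fun j hj => hl j (by simp [hj]),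
      gen_last i (hl i (by simp))]

/-! ### Windows -/

lemma window_injOn {v w : Equiv.Perm (Dom 4)} (hv : v ∈ Dgroup 4) (hw : w ∈ Dgroup 4)
    (h : window v = window w) : v = w := by
  simp only [window, Prod.mk.injEq, toInt_injective.eq_iff] at h
  obtain ⟨h0, h1, h2, h3⟩ := h
  have hpos : ∀ k : Fin 5, v (k, true) = w (k, true) := by
    intro k
    fin_cases k
    · exact h0
    · exact h1
    · exact h2
    · exact h3
    · exact (map_last hv true).trans (map_last hw true).symm
  ext1 ⟨k, b⟩
  cases b
  · have e1 := map_flip hv (k, true)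
    have e2 := map_flip hw (k, true)
    rw [hpos k] at e1
    exact e1.trans e2.symm
  · exact hpos k

lemma window_gen_mul {i : ℕ} (hi : i < 4) (w : Equiv.Perm (Dom 4)) :
    window (gen 4 i * w) = leftAct i (window w) := by
  simp [window, leftAct, toInt_gen i hi]

lemma window_ofWord_mul {l : List ℕ} (hl : ∀ i ∈ l, i < 4) (w : Equiv.Perm (Dom 4)) :
    window (ofWord l * w) = l.foldr leftAct (window w) := by
  induction l with
  | nil => simp [ofWord]
  | cons i l ih =>
    rw [ofWord_cons, mul_assoc, window_gen_mul (hl i (by simp)),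
      ih fun j hj => hl j (by simp [hj]), List.foldr_cons]

lemma window_one : window 1 = (1, 2, 3, 4) := by decide +kernel

lemma window_ofWord {l : List ℕ} (hl : ∀ i ∈ l, i < 4) : window (ofWord l) = wordWindow l := by
  rw [wordWindow, ← window_one, ← window_ofWord_mul hl, mul_one]

lemma window_mul_gen {i : ℕ} (hi : i < 4) {w : Equiv.Perm (Dom 4)} (hw : w ∈ Dgroup 4) :
    window (w * gen 4 i) = rightAct i (window w) := by
  have hneg : ∀ k : Fin 5, toInt (w (k, false)) = -toInt (w (k, true)) := fun k => by
    rw [← toInt_flip]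
    exact congrArg toInt (map_flip hw (k, true))
  have key : ∀ i < 4, [gen 4 i (0, true), gen 4 i (1, true), gen 4 i (2, true),
      gen 4 i (3, true)] =
        if i = 0 then [(1, false), (0, false), (2, true), (3, true)]
        else if i = 1 then [(1, true), (0, true), (2, true), (3, true)]
        else if i = 2 then [(0, true), (2, true), (1, true), (3, true)]
        else [(0, true), (1, true), (3, true), (2, true)] := by decide +kernel
  have h := key i hi
  interval_cases i <;> norm_num only [List.cons.injEq, if_true, if_false] at h <;>
    obtain ⟨h0, h1, h2, h3⟩ := h <;>
    simp only [window, Equiv.Perm.mul_apply, h0, h1, h2, h3, rightAct, hneg]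

lemma window_mem {w : Equiv.Perm (Dom 4)} (hw : w ∈ Dgroup 4) : window w ∈ windows := by
  have key : ∀ y ∈ windows, ∀ i < 4, leftAct i y ∈ windows := by decide +kernel
  obtain ⟨l, hl, rfl⟩ := mem_Dgroup.1 hw
  clear hw
  induction l with
  | nil =>
    rw [show ofWord [] = 1 from rfl, window_one]
    decide +kernel
  | cons i l ih =>
    rw [ofWord_cons, window_gen_mul (hl i (by simp))]
    exact key _ (ih fun j hj => hl j (by simp [hj])) i (hl i (by simp))

/-! ### Length and minimal coset representatives -/

lemma inversions_rightAct : ∀ y ∈ windows, ∀ i < 4,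
    if isDescent i y then inversions (rightAct i y) + 1 = inversions y
    else inversions (rightAct i y) = inversions y + 1 := by decide +kernel

lemma inversions_mul_gen {i : ℕ} (hi : i < 4) {w : Equiv.Perm (Dom 4)} (hw : w ∈ Dgroup 4) :
    if isDescent i (window w) then inversions (window (w * gen 4 i)) + 1 = inversions (window w)
    else inversions (window (w * gen 4 i)) = inversions (window w) + 1 := by
  rw [window_mul_gen hi hw]
  exact inversions_rightAct _ (window_mem hw) i hi

lemma inversions_ofWord_le {l : List ℕ} (hl : ∀ i ∈ l, i < 4) :
    inversions (window (ofWord l)) ≤ l.length := by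
  induction l using List.reverseRecOn with
  | nil =>
    rw [show ofWord [] = 1 from rfl, window_one]
    decide +kernel
  | append_singleton l i ih =>
    have hl' : ∀ j ∈ l, j < 4 := fun j hj => hl j (by simp [hj])
    have h := inversions_mul_gen (hl i (by simp)) (ofWord_mem hl')
    have := ih hl'
    rw [ofWord_append, show ofWord [i] = gen 4 i by simp [ofWord], List.length_append,
      List.length_singleton]
    split_ifs at h <;> omega

lemma exists_word_length {w : Equiv.Perm (Dom 4)} (hw : w ∈ Dgroup 4) :
    ∃ l : List ℕ, (∀ i ∈ l, i < 4) ∧ l.length = inversions (window w) ∧ ofWord l = w := by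
  have key : ∀ y ∈ windows, y = (1, 2, 3, 4) ∨ ∃ i < 4, isDescent i y = true := by decide +kernel
  induction hk : inversions (window w) generalizing w with
  | zero =>
    rcases key _ (window_mem hw) with h | ⟨i, hi, hd⟩
    · exact ⟨[], by simp, rfl, window_injOn (ofWord_mem (by simp)) hw (window_one.trans h.symm)⟩
    · have := inversions_mul_gen hi hw
      simp only [hd, if_true] at this
      omega
  | succ k ih =>
    rcases key _ (window_mem hw) with h | ⟨i, hi, hd⟩
    · rw [h] at hk
      exact absurd (hk.symm.trans (show inversions (1, 2, 3, 4) = 0 by decide +kernel)) (by simp)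
    · have := inversions_mul_gen hi hw
      simp only [hd, if_true] at this
      obtain ⟨l, hl, hlen, hprod⟩ := ih (mul_mem hw (gen_mem hi)) (by omega)
      refine ⟨l ++ [i], ?_, by simp [hlen], ?_⟩
      · intro j hj
        rcases List.mem_append.1 hj with hj | hj
        · exact hl j hj
        · rwa [List.mem_singleton.1 hj]
      · rw [ofWord_append, hprod, show ofWord [i] = gen 4 i by simp [ofWord], mul_assoc,
          gen_involutive i hi, mul_one]

lemma len_eq_inversions {w : Equiv.Perm (Dom 4)} (hw : w ∈ Dgroup 4) :
    len 4 w = inversions (window w) := by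
  have hmem := exists_word_length hw
  refine le_antisymm (Nat.sInf_le hmem) (le_csInf ⟨_, hmem⟩ ?_)
  rintro k ⟨l, hl, rfl, rfl⟩
  exact inversions_ofWord_le hl

/-- The parabolic types occurring in the multiplication example. -/
def exampleTypes : List (List ℕ) := [[1, 2, 3], [0, 1, 3], [1, 3], [0]]

lemma removeDescents_rightAct : ∀ J ∈ exampleTypes, ∀ y ∈ windows, ∀ i ∈ J,
    removeDescents J 12 (rightAct i y) = removeDescents J 12 y := by decide +kernel

lemma inversions_removeDescents_le : ∀ J ∈ exampleTypes, ∀ y ∈ windows,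
    inversions (removeDescents J 12 y) ≤ inversions y := by decide +kernel

lemma removeDescents_of_noDescent : ∀ J ∈ exampleTypes, ∀ y ∈ windows,
    noDescent J y = true → removeDescents J 12 y = y := by decide +kernel

lemma removeDescents_mul_ofWord {J : List ℕ} (hJ : J ∈ exampleTypes) (hJ4 : ∀ i ∈ J, i < 4)
    {w : Equiv.Perm (Dom 4)} (hw : w ∈ Dgroup 4) {l : List ℕ} (hl : ∀ i ∈ l, i ∈ J) :
    removeDescents J 12 (window (w * ofWord l)) = removeDescents J 12 (window w) := by
  induction l generalizing w with
  | nil => simp [ofWord]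
  | cons i l ih =>
    have hi : i ∈ J := hl i (by simp)
    rw [ofWord_cons, ← mul_assoc, ih (mul_mem hw (gen_mem (hJ4 i hi))) fun j hj =>
      hl j (by simp [hj]), window_mul_gen (hJ4 i hi) hw, removeDescents_rightAct J hJ _ (window_mem hw) i hi]

lemma mem_X_iff {J : List ℕ} (hJ : J ∈ exampleTypes) {w : Equiv.Perm (Dom 4)} :
    w ∈ X 4 {i | i ∈ J} ↔ w ∈ Dgroup 4 ∧ noDescent J (window w) = true := by
  have hJ4 : ∀ i ∈ J, i < 4 := by
    revert J
    decide
  refine and_congr_right fun hw => ⟨fun h => ?_, fun h u hu => ?_⟩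
  · refine List.all_eq_true.2 fun i hi => ?_
    have h1 := h (gen 4 i) (Subgroup.subset_closure ⟨i, hi, rfl⟩)
    rw [len_eq_inversions hw, len_eq_inversions (mul_mem hw (gen_mem (hJ4 i hi)))] at h1
    have h2 := inversions_mul_gen (hJ4 i hi) hw
    cases hd : isDescent i (window w)
    · rfl
    · simp only [hd, if_true] at h2
      omega
  · obtain ⟨l, hl, rfl⟩ := exists_word (J := {i | i ∈ J}) hJ4 hu
    have hwl : w * ofWord l ∈ Dgroup 4 := mul_mem hw (ofWord_mem fun i hi => hJ4 i (hl i hi))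
    rw [len_eq_inversions hw, len_eq_inversions hwl,
      ← removeDescents_of_noDescent J hJ _ (window_mem hw) h,
      ← removeDescents_mul_ofWord hJ hJ4 hw hl]
    exact inversions_removeDescents_le J hJ _ (window_mem hwl)

/-! ### The product -/

lemma coeff_XX (n : ℕ) (J : Set ℕ) (g : Equiv.Perm (Dom n)) :
    (XX n J).coeff g = if g ∈ X n J then 1 else 0 := by
  have h : ∀ w : Equiv.Perm (Dom n),
      (if w ∈ X n J then MonoidAlgebra.of ℚ (Equiv.Perm (Dom n)) w else 0).coeff g =
        if w = g then (if w ∈ X n J then 1 else 0) else 0 := by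
    intro w
    by_cases hw : w ∈ X n J <;> simp [hw, Finsupp.single_apply]
  rw [XX, MonoidAlgebra.coeff_sum, Finsupp.finsetSum_apply, Finset.sum_congr rfl fun w _ => h w,
    Finset.sum_ite_eq' Finset.univ g, if_pos (Finset.mem_univ g)]

lemma coeff_XX_eq_noDescent {J : List ℕ} (hJ : J ∈ exampleTypes) (g : Equiv.Perm (Dom 4)) :
    (XX 4 {i | i ∈ J}).coeff g =
      if g ∈ Dgroup 4 then ((noDescent J (window g)).toNat : ℚ) else 0 := by
  rw [coeff_XX]
  by_cases hg : g ∈ Dgroup 4 <;> cases h : noDescent J (window g) <;> simp [mem_X_iff hJ, hg, h]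

lemma cosetWords_lt : ∀ l ∈ cosetWords, ∀ i ∈ l, i < 4 := by decide +kernel

lemma coeff_list_sum (L : List (MonoidAlgebra ℚ (Equiv.Perm (Dom 4)))) (g : Equiv.Perm (Dom 4)) :
    L.sum.coeff g = (L.map fun x => x.coeff g).sum := by
  induction L with
  | nil => simp
  | cons x L ih => simp [ih]

lemma XX_eq_sum_cosetWords : XX 4 {i | i ∈ [1, 2, 3]} =
    (cosetWords.map fun l => MonoidAlgebra.single (ofWord l) (1 : ℚ)).sum := by
  have key : ∀ y ∈ windows, (noDescent [1, 2, 3] y).toNat =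
      (cosetWords.map fun l => if wordWindow l = y then 1 else 0).sum := by decide +kernel
  ext g
  rw [coeff_list_sum, List.map_map]
  by_cases hg : g ∈ Dgroup 4
  · rw [coeff_XX_eq_noDescent (by simp [exampleTypes]), if_pos hg, key _ (window_mem hg), Nat.cast_list_sum,
      List.map_map]
    refine congrArg List.sum (List.map_congr_left fun l hl => ?_)
    have h : wordWindow l = window g ↔ ofWord l = g := by
      rw [← window_ofWord (cosetWords_lt l hl)]
      exact ⟨window_injOn (ofWord_mem (cosetWords_lt l hl)) hg, congrArg window⟩
    simp [h, Finsupp.single_apply]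
  · rw [coeff_XX_eq_noDescent (by simp [exampleTypes]), if_neg hg, eq_comm]
    refine List.sum_eq_zero fun x hx => ?_
    obtain ⟨l, hl, rfl⟩ := List.mem_map.1 hx
    have h : ofWord l ≠ g := fun h => hg (h ▸ ofWord_mem (cosetWords_lt l hl))
    simp [h]

lemma sum_noDescent_leftAct : ∀ y ∈ windows,
    (cosetWords.map fun l => (noDescent [0, 1, 3] (l.reverse.foldr leftAct y)).toNat).sum =
      2 * (noDescent [1, 3] y).toNat + (noDescent [0] y).toNat := by decide +kernel

lemma coeff_sum_cosetWords_mul (x : MonoidAlgebra ℚ (Equiv.Perm (Dom 4)))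
    (g : Equiv.Perm (Dom 4)) :
    ((cosetWords.map fun l => MonoidAlgebra.single (ofWord l) (1 : ℚ)).sum * x).coeff g =
      (cosetWords.map fun l => x.coeff (ofWord l.reverse * g)).sum := by
  rw [← List.sum_map_mul_right, coeff_list_sum, List.map_map]
  refine congrArg List.sum (List.map_congr_left fun l hl => ?_)
  rw [Function.comp_apply, MonoidAlgebra.coeff_single_mul_apply, one_mul,
    ofWord_inv (cosetWords_lt l hl)]

/-- The multiplication rule for elements known only through their coefficients: keeping them
abstract prevents the kernel from unfolding the sums defining `XX`. -/
lemma sum_cosetWords_mul_eq {x y z : MonoidAlgebra ℚ (Equiv.Perm (Dom 4))}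
    (hx : ∀ g, x.coeff g =
      if g ∈ Dgroup 4 then ((noDescent [0, 1, 3] (window g)).toNat : ℚ) else 0)
    (hy : ∀ g, y.coeff g =
      if g ∈ Dgroup 4 then ((noDescent [1, 3] (window g)).toNat : ℚ) else 0)
    (hz : ∀ g, z.coeff g =
      if g ∈ Dgroup 4 then ((noDescent [0] (window g)).toNat : ℚ) else 0) :
    (cosetWords.map fun l => MonoidAlgebra.single (ofWord l) (1 : ℚ)).sum * x =
      (2 : ℚ) • y + z := by
  ext g
  rw [coeff_sum_cosetWords_mul, MonoidAlgebra.coeff_add, Finsupp.add_apply,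
    MonoidAlgebra.coeff_smul_apply, hy, hz]
  have hrev : ∀ l ∈ cosetWords, ∀ i ∈ l.reverse, i < 4 := fun l hl i hi =>
    cosetWords_lt l hl i (List.mem_reverse.1 hi)
  by_cases hg : g ∈ Dgroup 4
  · rw [if_pos hg, if_pos hg, smul_eq_mul]
    have h := congrArg (Nat.cast : ℕ → ℚ) (sum_noDescent_leftAct _ (window_mem hg))
    rw [Nat.cast_list_sum, List.map_map, Nat.cast_add, Nat.cast_mul, Nat.cast_ofNat] at h
    rw [← h]
    refine congrArg List.sum (List.map_congr_left fun l hl => ?_)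
    rw [Function.comp_apply, hx, if_pos (mul_mem (ofWord_mem (hrev l hl)) hg),
      window_ofWord_mul (hrev l hl)]
  · rw [if_neg hg, if_neg hg, smul_zero, add_zero]
    refine List.sum_eq_zero fun x hx' => ?_
    obtain ⟨l, hl, rfl⟩ := List.mem_map.1 hx'
    rw [hx, if_neg fun h => hg ((Subgroup.mul_mem_cancel_left _ (ofWord_mem (hrev l hl))).1 h)]

lemma compl_JofC_four : Set.Iio 4 \ JofC 4 Kind.reg [4] = {i | i ∈ [1, 2, 3]} := by
  ext i
  simp only [JofC, psum, Set.mem_sdiff, Set.mem_Iio, Set.mem_union, Set.mem_singleton_iff,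
    Set.mem_ofPred_eq, List.length_cons, List.length_nil, List.mem_cons, List.not_mem_nil,
    or_false, zero_add]
  constructor
  · rintro ⟨h, h'⟩
    push Not at h'
    omega
  · intro h
    refine ⟨by omega, ?_⟩
    rintro (h0 | ⟨j, h1, h2, -⟩) <;> omega

lemma compl_JofC_two : Set.Iio 4 \ JofC 4 Kind.lt [2] = {i | i ∈ [0, 1, 3]} := by
  ext i
  simp [JofC, psum]
  omega

lemma compl_JofC_two_two : Set.Iio 4 \ JofC 4 Kind.reg [2, 2] = {i | i ∈ [1, 3]} := by
  ext i
  simp only [JofC, psum, Set.mem_sdiff, Set.mem_Iio, Set.mem_union, Set.mem_singleton_iff,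
    Set.mem_ofPred_eq, List.length_cons, List.length_nil, List.mem_cons, List.not_mem_nil,
    or_false, zero_add]
  constructor
  · rintro ⟨h, h'⟩
    have h1 : i ≠ 2 := fun h2 => h' (Or.inr ⟨1, by simp, by simp, by simp [h2]⟩)
    omega
  · intro h
    refine ⟨by omega, ?_⟩
    rintro (h0 | ⟨j, h1, h2, h3⟩)
    · omega
    · obtain rfl : j = 1 := by omega
      simp at h3
      omega

lemma compl_JofC_two_one_one : Set.Iio 4 \ JofC 4 Kind.prime [2, 1, 1] = {i | i ∈ [0]} := by
  ext i
  simp only [JofC, psum, Set.mem_sdiff, Set.mem_Iio, Set.mem_union, Set.mem_singleton_iff,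
    Set.mem_ofPred_eq, List.length_cons, List.length_nil, List.mem_cons, List.not_mem_nil,
    or_false, zero_add]
  constructor
  · rintro ⟨h, h'⟩
    have h1 : i ≠ 2 := fun h2 => h' (Or.inr ⟨1, by simp, by simp, by simp [h2]⟩)
    have h3 : i ≠ 3 := fun h2 => h' (Or.inr ⟨2, by simp, by simp, by simp [h2]⟩)
    omega
  · intro h
    refine ⟨by omega, ?_⟩
    rintro (h0 | ⟨j, h1, h2, h3⟩)
    · omega
    · obtain rfl | rfl : j = 1 ∨ j = 2 := by omega
      all_goals
        simp at h3
        omega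

/-- Example: `B_[4] B_[2] = 2B_[2,2] + B_[2,1,1]ʹ` in `ΣD_4`. -/
theorem example_mult_4 :
    B 4 Kind.reg [4] * B 4 Kind.lt [2] =
      (2 : ℚ) • B 4 Kind.reg [2, 2] + B 4 Kind.prime [2, 1, 1] := by
  simp only [B, compl_JofC_four, compl_JofC_two, compl_JofC_two_two, compl_JofC_two_one_one]
  rw [XX_eq_sum_cosetWords]
  exact sum_cosetWords_mul_eq (coeff_XX_eq_noDescent (by simp [exampleTypes]))
    (coeff_XX_eq_noDescent (by simp [exampleTypes]))
    (coeff_XX_eq_noDescent (by simp [exampleTypes]))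

end DescentD
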